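/- Let A be a traceless operator on the first k' sites with ‖A‖ = 1. Assume the following eigenstate thermalization hypothesis: there are constants ε ∈ (0,1), M ≥ 0, K ≥ 0 and, for each N, a function g_N : [−ε,ε] → {z ∈ ℂ : |z| ≤ 1} together with complex numbers a_N, b_N, c_N with |a_N|, |b_N|, |c_N| ≤ M such that |g_N(x) − a_N − b_N x − (c_N/2)x²| ≤ M|x|³ for all x ∈ [−ε,ε], and |⟨j|A|j⟩ − g_N(E_j/N)| ≤ K/N² for every j with |E_j| ≤ Nε. Then there is a constant C such that |a_N| ≤ C/N for all sufficiently large N (i.e., g_N(0) = O(1/N)). -/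

import Mathlib

open Matrix MeasureTheory Filter

/-- The space of operators on a chain of `N` qudits, each of local dimension `dloc`. -/
abbrev Op (dloc N : ℕ) := Matrix (Fin N → Fin dloc) (Fin N → Fin dloc) ℂ

/-- Cyclic translation of qudit configurations: site `i` of the new configuration carries
the value of site `i - 1` of the old one. -/
def confShift (dloc N : ℕ) : Equiv.Perm (Fin N → Fin dloc) :=
  Equiv.arrowCongr (finRotate N) (Equiv.refl (Fin dloc))

/-- The translation operator `T` on a chain of `N` qudits, as a permutation matrix. -/
noncomputable def Tmat (dloc N : ℕ) : Op dloc N :=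
  fun x y => if x = confShift dloc N y then 1 else 0

/-- Extension of an operator on the first `m` sites to the `N`-site chain, by tensoring
with the identity on the remaining sites (the zero operator if `m > N`). -/
noncomputable def embed (dloc m N : ℕ) (a : Op dloc m) : Op dloc N :=
  if hm : m ≤ N then
    (fun x y => a (fun i => x (Fin.castLE hm i)) (fun i => y (Fin.castLE hm i)) *
      (if ∀ i : Fin N, m ≤ (i : ℕ) → x i = y i then 1 else 0))
  else 0

/-- The translation-invariant Hamiltonian `H_N = ∑_{l=0}^{N-1} T^l h T^{-l}` built from
a local term `h` on `k` sites. -/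
noncomputable def Ham (dloc k N : ℕ) (h : Op dloc k) : Op dloc N :=
  ∑ l : Fin N, Tmat dloc N ^ (l : ℕ) * embed dloc k N h * (Tmat dloc N)ᴴ ^ (l : ℕ)

/-- The operator norm (ℓ²→ℓ² norm) of a matrix. -/
noncomputable def opNorm {n : Type*} [Fintype n] [DecidableEq n] (A : Matrix n n ℂ) : ℝ :=
  ‖Matrix.toEuclideanCLM (𝕜 := ℂ) (n := n) A‖

/-- An orthonormal basis of simultaneous eigenvectors of the Hamiltonian `H` (with real
eigenvalues `E j`) and of the translation operator `T` (with eigenvalues `τ j`). -/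
structure EigData (dloc N : ℕ) (H : Op dloc N) where
  v : (Fin N → Fin dloc) → ((Fin N → Fin dloc) → ℂ)
  E : (Fin N → Fin dloc) → ℝ
  τ : (Fin N → Fin dloc) → ℂ
  orth : ∀ j j', star (v j) ⬝ᵥ v j' = if j = j' then 1 else 0
  eigH : ∀ j, H.mulVec (v j) = (E j : ℂ) • v j
  eigT : ∀ j, (Tmat dloc N).mulVec (v j) = τ j • v j

/-- The eigenstate expectation value `⟨j|B|j⟩`. -/
noncomputable def eev {dloc N : ℕ} {H : Op dloc N} (D : EigData dloc N H)
    (B : Op dloc N) (j : Fin N → Fin dloc) : ℂ :=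
  star (D.v j) ⬝ᵥ B.mulVec (D.v j)

/-- `r_f(N) = ((1/d) ∑_j |⟨j|B|j⟩ - f(E_j/N)|²)^{1/2}`. -/
noncomputable def rf {dloc N : ℕ} {H : Op dloc N} (D : EigData dloc N H)
    (B : Op dloc N) (f : ℝ → ℂ) : ℝ :=
  Real.sqrt ((1 / (dloc : ℝ) ^ N) * ∑ j, ‖eev D B j - f (D.E j / N)‖ ^ 2)

/-- A function `f : [-1,1] → {z : ℂ, |z| ≤ 1}` (encoded as a total function on `ℝ`)
is smooth with Taylor data `c0 = f(0)`, `c1 = f'(0)`, `c2 = f''(0)` and remainder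
constant `M` if `|f(x) - c0 - c1 x - (c2/2) x²| ≤ M |x|³` on `[-1,1]`. -/
def SmoothFn (f : ℝ → ℂ) (c0 c1 c2 : ℂ) (M : ℝ) : Prop :=
  0 ≤ M ∧ (∀ x ∈ Set.Icc (-1 : ℝ) 1, ‖f x‖ ≤ 1) ∧
    ∀ x ∈ Set.Icc (-1 : ℝ) 1, ‖f x - c0 - c1 * x - c2 / 2 * x ^ 2‖ ≤ M * |x| ^ 3

/-- The generalized Pauli string `X^{a_1}Z^{b_1} ⊗ ⋯ ⊗ X^{a_m}Z^{b_m}` on `m` qudits,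
where `X|x⟩ = |x+1 mod dloc⟩` and `Z|x⟩ = ω^x |x⟩` with `ω = exp(2πi/dloc)`. -/
noncomputable def pauli (dloc m : ℕ) (a b : Fin m → Fin dloc) : Op dloc m :=
  fun x y =>
    if ∀ i, (x i : ℕ) = ((y i : ℕ) + (a i : ℕ)) % dloc then
      ∏ i, Complex.exp (2 * Real.pi * Complex.I * (b i : ℕ) * (y i : ℕ) / dloc)
    else 0

/-- An operator on `k` sites is canonical if every generalized Pauli string with nonzero
coefficient in its expansion acts nontrivially on site 1. -/
def Canonical (dloc k : ℕ) (h : Op dloc k) : Prop :=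
  ∀ a b : Fin k → Fin dloc,
    (∀ i : Fin k, (i : ℕ) = 0 → (a i : ℕ) = 0 ∧ (b i : ℕ) = 0) →
      Matrix.trace ((pauli dloc k a b)ᴴ * h) = 0

/-- An operator on `k` sites is exactly `k`-local if some generalized Pauli string with
nonzero coefficient in its expansion acts nontrivially on site `k`. -/
def ExactlyLocal (dloc k : ℕ) (h : Op dloc k) : Prop :=
  ∃ a b : Fin k → Fin dloc, ∃ i : Fin k, (i : ℕ) = k - 1 ∧ ((a i : ℕ) ≠ 0 ∨ (b i : ℕ) ≠ 0) ∧
    Matrix.trace ((pauli dloc k a b)ᴴ * h) ≠ 0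

/-- The submodule (over `ℝ`) of traceless operators on `k'` sites. -/
noncomputable def tracelessOps (dloc k' : ℕ) : Submodule ℝ (Op dloc k') :=
  LinearMap.ker ((Matrix.traceLinearMap (Fin k' → Fin dloc) ℂ ℂ).restrictScalars ℝ)

/-- The translation average `𝔸 = (1/N) ∑_{l=0}^{N-1} T^l A T^{-l}` of an operator. -/
noncomputable def tavg (dloc N : ℕ) (A : Op dloc N) : Op dloc N :=
  ((N : ℂ))⁻¹ • ∑ l : Fin N, Tmat dloc N ^ (l : ℕ) * A * (Tmat dloc N)ᴴ ^ (l : ℕ)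

/-- The operator `a` acting on the sites `s 0, …, s (m - 1)` of a chain of `N` qudits. -/
noncomputable def siteOp {dloc m N : ℕ} (s : Fin m → Fin N) (a : Op dloc m) : Op dloc N :=
  fun x y => a (x ∘ s) (y ∘ s) * (if ∀ i, (∀ j, s j ≠ i) → x i = y i then 1 else 0)

lemma embed_eq_siteOp {dloc m N : ℕ} (hm : m ≤ N) (a : Op dloc m) :
    embed dloc m N a = siteOp (Fin.castLE hm) a := by
  have key : ∀ i : Fin N, m ≤ (i : ℕ) ↔ ∀ j, Fin.castLE hm j ≠ i := by
    intro i
    constructor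
    · intro hi j hj
      have := congrArg Fin.val hj
      simp only [Fin.val_castLE] at this
      omega
    · intro hi
      by_contra hlt
      exact hi ⟨i, by omega⟩ (by ext; simp)
  refine (dif_pos hm).trans ?_
  funext x y
  simp only [siteOp, key]
  rfl

lemma Tmat_conj {dloc N : ℕ} (B : Op dloc N) :
    Tmat dloc N * B * (Tmat dloc N)ᴴ
      = B.submatrix (confShift dloc N).symm (confShift dloc N).symm := by
  ext x y
  simp only [Matrix.mul_apply, Tmat, Matrix.conjTranspose_apply, Matrix.submatrix_apply,
    ← Equiv.symm_apply_eq]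
  simp [Finset.sum_ite_eq, apply_ite]

lemma siteOp_submatrix_confShift {dloc m N : ℕ} (s : Fin m → Fin N) (a : Op dloc m) :
    (siteOp s a).submatrix (confShift dloc N).symm (confShift dloc N).symm
      = siteOp (finRotate N ∘ s) a := by
  ext x y
  have h1 : ∀ z : Fin N → Fin dloc, (confShift dloc N).symm z = z ∘ finRotate N := fun _ => rfl
  have h2 : (∀ i, (∀ j, s j ≠ i) → (x ∘ finRotate N) i = (y ∘ finRotate N) i) ↔
      ∀ i, (∀ j, (finRotate N ∘ s) j ≠ i) → x i = y i := by
    rw [← (finRotate N).forall_congr_right (q := fun i =>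
      (∀ j, (finRotate N ∘ s) j ≠ i) → x i = y i)]
    simp
  simp only [siteOp, Matrix.submatrix_apply, h1, h2, Function.comp_assoc]

lemma Tmat_pow_conj_siteOp {dloc m N : ℕ} (s : Fin m → Fin N) (a : Op dloc m) (l : ℕ) :
    Tmat dloc N ^ l * siteOp s a * (Tmat dloc N)ᴴ ^ l
      = siteOp ((finRotate N)^[l] ∘ s) a := by
  induction l with
  | zero => simp
  | succ l ih =>
    rw [pow_succ', pow_succ, Function.iterate_succ', Function.comp_assoc,
      ← siteOp_submatrix_confShift, ← ih, ← Tmat_conj]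
    simp only [Matrix.mul_assoc]

lemma Ham_eq_sum_siteOp {dloc k N : ℕ} (hk : k ≤ N) (h : Op dloc k) :
    Ham dloc k N h = ∑ l : Fin N, siteOp ((finRotate N)^[l] ∘ Fin.castLE hk) h := by
  simp only [Ham, embed_eq_siteOp hk, Tmat_pow_conj_siteOp]

lemma val_finRotate_iterate {N : ℕ} (l : ℕ) (i : Fin N) :
    ((finRotate N)^[l] i : ℕ) = (i + l) % N := by
  obtain _ | n := N
  · exact i.elim0
  induction l with
  | zero => simp [Nat.mod_eq_of_lt i.isLt]
  | succ l ih =>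
    rw [Function.iterate_succ_apply', finRotate_apply, Fin.val_add, ih, Fin.val_one',
      ← Nat.add_mod, add_assoc]

lemma finRotate_iterate_injective {N : ℕ} (i : Fin N) :
    Function.Injective fun l : Fin N => (finRotate N)^[l] i := by
  intro l l' hl
  have h := congrArg Fin.val hl
  simp only [val_finRotate_iterate] at h
  have h' : (l : ℕ) ≡ l' [MOD N] := Nat.ModEq.add_left_cancel' (i : ℕ) h
  exact Fin.ext (h'.eq_of_lt_of_lt l.isLt l'.isLt)

/-- A function of the sites `s` with zero sum is orthogonal to every function of the other
sites. -/
lemma sum_comp_mul_eq_zero {dloc m N : ℕ} {s : Fin m → Fin N} (hs : Function.Injective s)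
    (f : (Fin m → Fin dloc) → ℂ) (hf : ∑ u, f u = 0) (G : (Fin N → Fin dloc) → ℂ)
    (hG : ∀ x y, (∀ i, (∀ j, s j ≠ i) → x i = y i) → G x = G y) :
    ∑ x, f (x ∘ s) * G x = 0 := by
  classical
  by_cases hne : Nonempty (Fin dloc)
  swap
  · have : ∀ x : Fin N → Fin dloc, f (x ∘ s) * G x = 0 := by
      intro x
      obtain _ | m := m
      · have : f (x ∘ s) = 0 := by
          rw [← hf, Fintype.sum_subsingleton _ (x ∘ s)]
        rw [this, zero_mul]
      · exact absurd ⟨x (s 0)⟩ hne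
    simp [this]
  obtain ⟨z⟩ := hne
  let e := Equiv.piEquivPiSubtypeProd (fun i => i ∈ Set.range s) (fun _ : Fin N => Fin dloc)
  let r : Fin m ≃ Set.range s := Equiv.ofInjective s hs
  let e' : (Fin m → Fin dloc) ≃ ((i : {i // i ∈ Set.range s}) → Fin dloc) :=
    Equiv.arrowCongr r (Equiv.refl _)
  rw [← e.symm.sum_comp, Fintype.sum_prod_type_right]
  refine Finset.sum_eq_zero fun w _ => ?_
  have hGc : ∀ u, G (e.symm (u, w)) = G (e.symm (fun _ => z, w)) := by
    intro u
    apply hG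
    intro i hi
    have : ¬ (i ∈ Set.range s) := by simpa using hi
    simp only [e, Equiv.piEquivPiSubtypeProd_symm_apply, dif_neg this]
  simp only [hGc, ← Finset.sum_mul]
  rw [← e'.sum_comp]
  have : ∀ u, (e.symm (e' u, w)) ∘ s = u := by
    intro u
    ext i
    simp [e, e', r, Equiv.piEquivPiSubtypeProd, Equiv.arrowCongr]
  simp [this, hf]

lemma eq_off_of_siteOp_ne_zero {dloc m N : ℕ} {s : Fin m → Fin N} {a : Op dloc m}
    {x y : Fin N → Fin dloc} (hxy : siteOp s a x y ≠ 0) (i : Fin N) (hi : ∀ j, s j ≠ i) :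
    x i = y i := by
  by_contra hc
  exact hxy (by rw [siteOp, if_neg fun hh => hc (hh i hi), mul_zero])

lemma trace_siteOp {dloc m N : ℕ} {s : Fin m → Fin N} (hs : Function.Injective s)
    {a : Op dloc m} (ha : a.trace = 0) : (siteOp s a).trace = 0 := by
  simpa [Matrix.trace, siteOp] using
    sum_comp_mul_eq_zero hs (fun u => a u u) (by simpa [Matrix.trace] using ha) (fun _ => 1)
      (by simp)

lemma trace_siteOp_mul_siteOp {dloc m N : ℕ} {s t : Fin m → Fin N}
    (hs : Function.Injective s) (hst : ∀ i j, s i ≠ t j)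
    {a : Op dloc m} (ha : a.trace = 0) : (siteOp s a * siteOp t a).trace = 0 := by
  rw [← sum_comp_mul_eq_zero hs (fun u => a u u) (by simpa [Matrix.trace] using ha)
    (fun x => a (x ∘ t) (x ∘ t))]
  · simp only [Matrix.trace, Matrix.diag_apply, Matrix.mul_apply]
    refine Finset.sum_congr rfl fun x _ => ?_
    rw [Finset.sum_eq_single x]
    · simp [siteOp]
    · intro y _ hyx
      by_contra hne
      apply hyx
      ext1 i
      obtain ⟨hs', ht'⟩ := mul_ne_zero_iff.mp hne
      by_cases hi : ∀ j, t j ≠ i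
      · exact eq_off_of_siteOp_ne_zero ht' i hi
      · push Not at hi
        obtain ⟨j, rfl⟩ := hi
        exact (eq_off_of_siteOp_ne_zero hs' (t j) fun i => hst i j).symm
    · simp
  · intro x y hxy
    have : x ∘ t = y ∘ t := by
      ext1 j
      exact hxy _ fun i => hst i j
    simp only [this]

lemma card_eq_off_le {dloc m N : ℕ} (s : Fin m → Fin N) (x : Fin N → Fin dloc) :
    (Finset.univ.filter fun y : Fin N → Fin dloc =>
      ∀ i, (∀ j, s j ≠ i) → x i = y i).card ≤ dloc ^ m := by
  have : dloc ^ m = (Finset.univ : Finset (Fin m → Fin dloc)).card := by simp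
  rw [this]
  refine Finset.card_le_card_of_injOn (fun y => y ∘ s) (by simp) ?_
  intro y hy y' hy' hyy
  simp only [Finset.coe_filter, Finset.mem_univ, true_and, Set.mem_ofPred_eq] at hy hy'
  ext1 i
  by_cases hi : ∀ j, s j ≠ i
  · rw [← hy i hi, ← hy' i hi]
  · push Not at hi
    obtain ⟨j, rfl⟩ := hi
    exact congrFun hyy j

lemma sum_norm_siteOp_row_le {dloc m N : ℕ} (s : Fin m → Fin N) {a : Op dloc m} {B : ℝ}
    (hB : ∀ u w, ‖a u w‖ ≤ B) (hB0 : 0 ≤ B) (x : Fin N → Fin dloc) :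
    ∑ y, ‖siteOp s a x y‖ ≤ B * dloc ^ m := by
  calc ∑ y, ‖siteOp s a x y‖
      ≤ ∑ y : Fin N → Fin dloc, if ∀ i, (∀ j, s j ≠ i) → x i = y i then B else 0 := by
        refine Finset.sum_le_sum fun y _ => ?_
        unfold siteOp
        split_ifs <;> simp [hB]
    _ = B * ((Finset.univ.filter fun y : Fin N → Fin dloc =>
          ∀ i, (∀ j, s j ≠ i) → x i = y i).card : ℝ) := by
        rw [← Finset.sum_filter, Finset.sum_const, nsmul_eq_mul, mul_comm]
    _ ≤ B * dloc ^ m := by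
        gcongr
        exact_mod_cast card_eq_off_le s x

lemma siteOp_conjTranspose {dloc m N : ℕ} (s : Fin m → Fin N) (a : Op dloc m) :
    (siteOp s a)ᴴ = siteOp s aᴴ := by
  ext x y
  have hxy : (∀ i, (∀ j, s j ≠ i) → y i = x i) ↔ ∀ i, (∀ j, s j ≠ i) → x i = y i := by
    simp only [eq_comm]
  simp only [siteOp, Matrix.conjTranspose_apply, hxy, star_mul']
  split_ifs <;> simp

lemma norm_siteOp_le {dloc m N : ℕ} (s : Fin m → Fin N) {a : Op dloc m} {B : ℝ}
    (hB : ∀ u w, ‖a u w‖ ≤ B) (hB0 : 0 ≤ B) (x y : Fin N → Fin dloc) :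
    ‖siteOp s a x y‖ ≤ B := by
  unfold siteOp
  split_ifs <;> simp [hB, hB0]

lemma norm_trace_siteOp_mul_siteOp_le {dloc m N : ℕ} (s t : Fin m → Fin N) {a : Op dloc m}
    {B : ℝ} (hB : ∀ u w, ‖a u w‖ ≤ B) (hB0 : 0 ≤ B) :
    ‖(siteOp s a * siteOp t a).trace‖ ≤ dloc ^ N * (B * dloc ^ m * B) := by
  simp only [Matrix.trace, Matrix.diag_apply, Matrix.mul_apply]
  calc ‖∑ x, ∑ y, siteOp s a x y * siteOp t a y x‖
      ≤ ∑ x : Fin N → Fin dloc, B * dloc ^ m * B := by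
        refine (norm_sum_le _ _).trans (Finset.sum_le_sum fun x _ => ?_)
        refine (norm_sum_le _ _).trans ?_
        calc ∑ y, ‖siteOp s a x y * siteOp t a y x‖
            ≤ ∑ y, ‖siteOp s a x y‖ * B := by
              refine Finset.sum_le_sum fun y _ => ?_
              rw [norm_mul]
              gcongr
              exact norm_siteOp_le t hB hB0 y x
          _ ≤ B * dloc ^ m * B := by
              rw [← Finset.sum_mul]
              gcongr
              exact sum_norm_siteOp_row_le s hB hB0 x
    _ = _ := by simp

/-- Schur test for quadratic forms. -/
lemma norm_dotProduct_mulVec_le {n : Type*} [Fintype n] (P : Matrix n n ℂ) (v : n → ℂ) {R : ℝ}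
    (hrow : ∀ x, ∑ y, ‖P x y‖ ≤ R) (hcol : ∀ y, ∑ x, ‖P x y‖ ≤ R) :
    ‖star v ⬝ᵥ P.mulVec v‖ ≤ R * ∑ x, ‖v x‖ ^ 2 := by
  calc ‖star v ⬝ᵥ P.mulVec v‖
      ≤ ∑ x, ∑ y, ‖v x‖ * (‖P x y‖ * ‖v y‖) := by
        simp only [dotProduct, Matrix.mulVec, Finset.mul_sum]
        refine (norm_sum_le _ _).trans (Finset.sum_le_sum fun x _ => ?_)
        refine (norm_sum_le _ _).trans (Finset.sum_le_sum fun y _ => ?_)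
        simp
    _ ≤ ∑ x, ∑ y, (‖P x y‖ * ‖v x‖ ^ 2 / 2 + ‖P x y‖ * ‖v y‖ ^ 2 / 2) := by
        refine Finset.sum_le_sum fun x _ => Finset.sum_le_sum fun y _ => ?_
        nlinarith [mul_nonneg (norm_nonneg (P x y)) (sq_nonneg (‖v x‖ - ‖v y‖))]
    _ = ∑ x, (∑ y, ‖P x y‖) * (‖v x‖ ^ 2 / 2) + ∑ y, (∑ x, ‖P x y‖) * (‖v y‖ ^ 2 / 2) := by
        simp only [Finset.sum_add_distrib]
        congr 1
        · simp only [Finset.sum_mul, mul_div_assoc]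
        · rw [Finset.sum_comm]
          simp only [Finset.sum_mul, mul_div_assoc]
    _ ≤ ∑ x, R * (‖v x‖ ^ 2 / 2) + ∑ y, R * (‖v y‖ ^ 2 / 2) := by
        gcongr
        · exact hrow _
        · exact hcol _
    _ = R * ∑ x, ‖v x‖ ^ 2 := by
        rw [← Finset.mul_sum, ← Finset.sum_div]
        ring

lemma EigData.sum_norm_sq {dloc N : ℕ} {H : Op dloc N} (D : EigData dloc N H)
    (j : Fin N → Fin dloc) : ∑ x, ‖D.v j x‖ ^ 2 = 1 := by
  have h := D.orth j j
  simp only [dotProduct, Pi.star_apply, RCLike.star_def, Complex.conj_mul', if_true] at h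
  exact_mod_cast h

lemma EigData.norm_eev_siteOp_le {dloc m N : ℕ} {H : Op dloc N} (D : EigData dloc N H)
    (s : Fin m → Fin N) {a : Op dloc m} {B : ℝ}
    (hB : ∀ u w, ‖a u w‖ ≤ B) (hB0 : 0 ≤ B) (j : Fin N → Fin dloc) :
    ‖eev D (siteOp s a) j‖ ≤ B * dloc ^ m := by
  refine (norm_dotProduct_mulVec_le (R := B * dloc ^ m) _ _
    (sum_norm_siteOp_row_le s hB hB0) fun y => ?_).trans ?_
  · have := sum_norm_siteOp_row_le s (a := aᴴ) (B := B) (by simpa using fun u w => hB w u) hB0 y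
    simpa [← siteOp_conjTranspose] using this
  · rw [D.sum_norm_sq, mul_one]

lemma EigData.sum_eev {dloc N : ℕ} {H : Op dloc N} (D : EigData dloc N H) (B : Op dloc N) :
    ∑ j, eev D B j = B.trace := by
  let V : Op dloc N := Matrix.of fun x j => D.v j x
  have hV : Vᴴ * V = 1 := by
    ext j j'
    rw [Matrix.one_apply, ← D.orth j j']
    rfl
  have hV' : V * Vᴴ = 1 := mul_eq_one_comm.mp hV
  have : ∑ j, eev D B j = (Vᴴ * (B * V)).trace := rfl
  rw [this, Matrix.trace_mul_comm, Matrix.mul_assoc, hV', Matrix.mul_one]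

lemma EigData.eev_self {dloc N : ℕ} {H : Op dloc N} (D : EigData dloc N H)
    (j : Fin N → Fin dloc) : eev D H j = D.E j := by
  simp [eev, D.eigH, D.orth]

lemma EigData.eev_mul_self {dloc N : ℕ} {H : Op dloc N} (D : EigData dloc N H)
    (j : Fin N → Fin dloc) : eev D (H * H) j = (D.E j : ℂ) ^ 2 := by
  simp [eev, ← Matrix.mulVec_mulVec, D.eigH, D.orth, Matrix.mulVec_smul, sq]

lemma iterate_comp_castLE_injective {k N : ℕ} (hk : k ≤ N) (l : ℕ) :
    Function.Injective ((finRotate N)^[l] ∘ Fin.castLE hk) :=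
  ((finRotate N).injective.iterate l).comp (Fin.castLE_injective hk)

lemma trace_Ham {dloc k N : ℕ} (hk : k ≤ N) {h : Op dloc k} (htr : h.trace = 0) :
    (Ham dloc k N h).trace = 0 := by
  rw [Ham_eq_sum_siteOp hk, Matrix.trace_sum]
  exact Finset.sum_eq_zero fun l _ => trace_siteOp (iterate_comp_castLE_injective hk l) htr

lemma norm_trace_Ham_mul_Ham_le {dloc k N : ℕ} (hk : k ≤ N) {h : Op dloc k}
    (htr : h.trace = 0) {B : ℝ} (hB : ∀ u w, ‖h u w‖ ≤ B) (hB0 : 0 ≤ B) :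
    ‖(Ham dloc k N h * Ham dloc k N h).trace‖
      ≤ N * (k * (k * (dloc ^ N * (B * dloc ^ k * B)))) := by
  set c : ℝ := dloc ^ N * (B * dloc ^ k * B)
  have hc : 0 ≤ c := by positivity
  let s : Fin N → Fin k → Fin N := fun l => (finRotate N)^[l] ∘ Fin.castLE hk
  have hpair : ∀ l l', ‖(siteOp (s l) h * siteOp (s l') h).trace‖
      ≤ ∑ i, ∑ i', if s l i = s l' i' then c else 0 := by
    intro l l'
    have hnn : ∀ i i', 0 ≤ if s l i = s l' i' then c else 0 := by
      intro i i'; split_ifs <;> simp [hc]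
    by_cases hd : ∀ i i', s l i ≠ s l' i'
    · rw [trace_siteOp_mul_siteOp (iterate_comp_castLE_injective hk l) hd htr, norm_zero]
      exact Finset.sum_nonneg fun i _ => Finset.sum_nonneg fun i' _ => hnn i i'
    · push Not at hd
      obtain ⟨i, i', hii⟩ := hd
      calc _ ≤ c := norm_trace_siteOp_mul_siteOp_le _ _ hB hB0
        _ = if s l i = s l' i' then c else 0 := by rw [if_pos hii]
        _ ≤ ∑ i', if s l i = s l' i' then c else 0 :=
          Finset.single_le_sum (f := fun i' => if s l i = s l' i' then c else 0)
            (fun i' _ => hnn i i') (Finset.mem_univ i')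
        _ ≤ _ :=
          Finset.single_le_sum (f := fun i => ∑ i', if s l i = s l' i' then c else 0)
            (fun i _ => Finset.sum_nonneg fun i' _ => hnn i i') (Finset.mem_univ i)
  have hcount : ∀ l i i', ∑ l', (if s l i = s l' i' then c else 0) ≤ c := by
    intro l i i'
    rw [← Finset.sum_filter, Finset.sum_const, nsmul_eq_mul]
    have : (Finset.univ.filter fun l' => s l i = s l' i').card ≤ 1 := by
      rw [Finset.card_le_one]
      intro p hp q hq
      simp only [Finset.mem_filter, Finset.mem_univ, true_and] at hp hq
      exact finRotate_iterate_injective (Fin.castLE hk i') (hp.symm.trans hq)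
    exact mul_le_of_le_one_left hc (by exact_mod_cast this)
  rw [Ham_eq_sum_siteOp hk, Finset.sum_mul_sum, Matrix.trace_sum]
  simp only [Matrix.trace_sum]
  calc _ ≤ ∑ l, ∑ l', ‖(siteOp (s l) h * siteOp (s l') h).trace‖ :=
        (norm_sum_le _ _).trans (Finset.sum_le_sum fun l _ => norm_sum_le _ _)
    _ ≤ ∑ l, ∑ l', ∑ i, ∑ i', (if s l i = s l' i' then c else 0) := by
        gcongr with l _ l' _
        exact hpair l l'
    _ = ∑ l, ∑ i, ∑ i', ∑ l', (if s l i = s l' i' then c else 0) := by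
        refine Finset.sum_congr rfl fun l _ => ?_
        rw [Finset.sum_comm]
        exact Finset.sum_congr rfl fun i _ => Finset.sum_comm
    _ ≤ ∑ l : Fin N, ∑ i : Fin k, ∑ i' : Fin k, c := by
        gcongr with l _ i _ i' _
        exact hcount l i i'
    _ = _ := by simp

/-- A matrix has uniformly bounded entries. -/
lemma exists_norm_entry_le {n : Type*} [Fintype n] (a : Matrix n n ℂ) :
    ∃ B : ℝ, 0 ≤ B ∧ ∀ u w, ‖a u w‖ ≤ B := by
  refine ⟨∑ u, ∑ w, ‖a u w‖, by positivity, fun u w => ?_⟩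
  exact (Finset.single_le_sum (f := fun w => ‖a u w‖) (fun _ _ => norm_nonneg _)
    (Finset.mem_univ w)).trans (Finset.single_le_sum (f := fun u => ∑ w, ‖a u w‖)
      (fun _ _ => by positivity) (Finset.mem_univ u))

/-- If `z` is approximated by a quadratic Taylor polynomial on `[-ε, ε]` and is bounded elsewhere,
then it is affine in `x` up to a quadratic error everywhere. -/
lemma norm_sub_affine_le {ε M R δ x : ℝ} {z a b c : ℂ} (hε : 0 < ε) (hε1 : ε < 1)
    (hM : 0 ≤ M) (hδ : 0 ≤ δ) (hR : 0 ≤ R) (ha : ‖a‖ ≤ M) (hb : ‖b‖ ≤ M) (hc : ‖c‖ ≤ M)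
    (hz : ‖z‖ ≤ R) (hin : |x| ≤ ε → ‖z - a - b * x - c / 2 * x ^ 2‖ ≤ δ + M * |x| ^ 3) :
    ‖z - a - b * x‖ ≤ δ + (2 * M + (R + 2 * M) / ε ^ 2) * x ^ 2 := by
  have hx0 := abs_nonneg x
  have hx2 : |x| ^ 2 = x ^ 2 := sq_abs x
  have hnx : ‖(x : ℂ)‖ = |x| := by simp
  have hRM : 0 ≤ (R + 2 * M) / ε ^ 2 := by positivity
  rcases le_or_gt |x| ε with hx | hx
  · have h1 : ‖z - a - b * x‖ ≤ ‖z - a - b * x - c / 2 * x ^ 2‖ + ‖c / 2 * (x : ℂ) ^ 2‖ := by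
      have := norm_add_le (z - a - b * x - c / 2 * x ^ 2) (c / 2 * (x : ℂ) ^ 2)
      rwa [sub_add_cancel] at this
    have h2 : ‖c / 2 * (x : ℂ) ^ 2‖ ≤ M / 2 * x ^ 2 := by
      rw [norm_mul, norm_pow, hnx, hx2, norm_div]
      gcongr
      simp
    have h3 : M * |x| ^ 3 ≤ M * x ^ 2 := by
      gcongr
      rw [← hx2]
      exact pow_le_pow_of_le_one hx0 (by linarith) (by norm_num)
    nlinarith [hin hx, mul_nonneg hRM (sq_nonneg x), mul_nonneg hM (sq_nonneg x)]
  · have h1 : ‖z - a - b * x‖ ≤ R + M + M * |x| := by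
      refine (norm_sub_le _ _).trans (add_le_add ((norm_sub_le _ _).trans (add_le_add hz ha)) ?_)
      rw [norm_mul, hnx]
      gcongr
    have h2 : 1 ≤ |x| / ε := (one_le_div hε).2 hx.le
    have h3 : |x| ≤ |x| / ε := le_div_self hx0 hε hε1.le
    have h4 : (R + 2 * M) / ε ^ 2 * x ^ 2 = (R + 2 * M) * (|x| / ε) ^ 2 := by
      rw [div_pow, hx2]; ring
    have h5 : 1 ≤ (|x| / ε) ^ 2 := one_le_pow₀ h2
    have h6 : |x| ≤ (|x| / ε) ^ 2 := h3.trans (le_self_pow₀ h2 (by norm_num))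
    nlinarith [mul_nonneg hM (sq_nonneg x), mul_le_mul_of_nonneg_left h5 hR,
      mul_le_mul_of_nonneg_left h5 hM, mul_le_mul_of_nonneg_left h6 hM]

/-- Under the ETH ansatz with Taylor data `(a_N, b_N, c_N)` for `g_N` and
accuracy `K/N²` in the middle of the spectrum, one has `g_N(0) = a_N = O(1/N)`. -/
theorem eth_g_zero (dloc k k' : ℕ) (hdloc : 2 ≤ dloc) (hk : 1 ≤ k)
    (h : Op dloc k) (hherm : h.IsHermitian) (htr : h.trace = 0) (hnorm : opNorm h = 1)
    (D : ∀ N, EigData dloc N (Ham dloc k N h))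
    (A : Op dloc k') (hAtr : A.trace = 0) (hAnorm : opNorm A = 1)
    (ε M K : ℝ) (hε : ε ∈ Set.Ioo (0 : ℝ) 1) (hM : 0 ≤ M) (hK : 0 ≤ K)
    (g : ℕ → ℝ → ℂ) (a b c : ℕ → ℂ)
    (hgbd : ∀ N : ℕ, ∀ x ∈ Set.Icc (-ε) ε, ‖g N x‖ ≤ 1)
    (habc : ∀ N : ℕ, ‖a N‖ ≤ M ∧ ‖b N‖ ≤ M ∧ ‖c N‖ ≤ M)
    (htaylor : ∀ N : ℕ, ∀ x ∈ Set.Icc (-ε) ε,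
      ‖g N x - a N - b N * x - c N / 2 * x ^ 2‖ ≤ M * |x| ^ 3)
    (heth : ∀ N : ℕ, ∀ j, |(D N).E j| ≤ N * ε →
      ‖eev (D N) (embed dloc k' N A) j - g N ((D N).E j / N)‖ ≤ K / (N : ℝ) ^ 2) :
    ∃ C : ℝ, ∃ N₀ : ℕ, ∀ N : ℕ, N₀ ≤ N → ‖a N‖ ≤ C / N := by
  obtain ⟨B, hB0, hB⟩ := exists_norm_entry_le h
  obtain ⟨B', hB'0, hB'⟩ := exists_norm_entry_le A
  obtain ⟨hε0, hε1⟩ := hε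
  set R : ℝ := B' * dloc ^ k' with hRdef
  set Q : ℝ := 2 * M + (R + 2 * M) / ε ^ 2 with hQdef
  set S : ℝ := k * (k * (B * dloc ^ k * B)) with hSdef
  have hR : 0 ≤ R := by positivity
  have hQ : 0 ≤ Q := by positivity
  refine ⟨K + Q * S, k + k' + 1, fun N hN => ?_⟩
  have hkN : k ≤ N := by omega
  have hk'N : k' ≤ N := by omega
  have hNpos : (0 : ℝ) < N := by exact_mod_cast (by omega : 0 < N)
  have hN1 : (1 : ℝ) ≤ N := by exact_mod_cast (by omega : 1 ≤ N)
  set d : ℝ := (dloc : ℝ) ^ N with hd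
  have hdpos : 0 < d := by positivity
  set x : (Fin N → Fin dloc) → ℝ := fun j => (D N).E j / N with hx
  set z : (Fin N → Fin dloc) → ℂ := fun j => eev (D N) (embed dloc k' N A) j with hz
  have hpt : ∀ j, ‖z j - a N - b N * x j‖ ≤ K / (N : ℝ) ^ 2 + Q * x j ^ 2 := by
    intro j
    obtain ⟨ha, hb, hc⟩ := habc N
    refine norm_sub_affine_le hε0 hε1 hM (by positivity) hR ha hb hc ?_ fun hxj => ?_
    · simp only [hz, embed_eq_siteOp hk'N]
      exact (D N).norm_eev_siteOp_le _ hB' hB'0 j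
    · have hE : |(D N).E j| ≤ N * ε := by
        rw [hx, abs_div, abs_of_pos hNpos, div_le_iff₀ hNpos] at hxj
        linarith
      have h1 := heth N j hE
      have h2 := htaylor N (x j) (abs_le.mp hxj)
      calc _ = ‖(z j - g N (x j)) + (g N (x j) - a N - b N * x j - c N / 2 * x j ^ 2)‖ := by
            congr 1; ring
        _ ≤ _ := (norm_add_le _ _).trans (add_le_add h1 h2)
  have hz0 : ∑ j, z j = 0 := by
    rw [hz, (D N).sum_eev, embed_eq_siteOp hk'N,
      trace_siteOp (Fin.castLE_injective hk'N) hAtr]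
  have hx1 : ∑ j, (x j : ℂ) = 0 := by
    have : ∑ j, ((D N).E j : ℂ) = 0 := by
      simp only [← EigData.eev_self, (D N).sum_eev, trace_Ham hkN htr]
    simp [hx, ← Finset.sum_div, this]
  have hx2 : ∑ j, x j ^ 2 ≤ d * (S / N) := by
    have h1 : ∑ j, ((D N).E j : ℂ) ^ 2 = (Ham dloc k N h * Ham dloc k N h).trace := by
      simp only [← EigData.eev_mul_self, (D N).sum_eev]
    have h2 : ∑ j, (D N).E j ^ 2 ≤ N * (d * S) := by
      calc ∑ j, (D N).E j ^ 2 = ‖((∑ j, (D N).E j ^ 2 : ℝ) : ℂ)‖ := by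
            rw [Complex.norm_of_nonneg (by positivity)]
        _ = ‖(Ham dloc k N h * Ham dloc k N h).trace‖ := by rw [← h1]; push_cast; rfl
        _ ≤ _ := norm_trace_Ham_mul_Ham_le hkN htr hB hB0
        _ = N * (d * S) := by rw [hSdef]; ring
    calc ∑ j, x j ^ 2 = (∑ j, (D N).E j ^ 2) / (N : ℝ) ^ 2 := by
          simp only [hx, div_pow, Finset.sum_div]
      _ ≤ N * (d * S) / (N : ℝ) ^ 2 := by gcongr
      _ = d * (S / N) := by field_simp
  have hcard : (Fintype.card (Fin N → Fin dloc) : ℝ) = d := by simp [hd]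
  have hsum : d * ‖a N‖ ≤ d * (K / (N : ℝ) ^ 2 + Q * (S / N)) := by
    calc d * ‖a N‖ = ‖∑ j, (z j - a N - b N * x j)‖ := by
          rw [Finset.sum_sub_distrib, Finset.sum_sub_distrib, hz0, ← Finset.mul_sum, hx1,
            Finset.sum_const, Finset.card_univ, nsmul_eq_mul, mul_zero, sub_zero, zero_sub,
            norm_neg, norm_mul, Complex.norm_natCast, hcard]
      _ ≤ ∑ j, (K / (N : ℝ) ^ 2 + Q * x j ^ 2) :=
          (norm_sum_le _ _).trans (Finset.sum_le_sum fun j _ => hpt j)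
      _ = d * (K / (N : ℝ) ^ 2) + Q * ∑ j, x j ^ 2 := by
          rw [Finset.sum_add_distrib, ← Finset.mul_sum, Finset.sum_const, Finset.card_univ,
            nsmul_eq_mul, hcard]
      _ ≤ d * (K / (N : ℝ) ^ 2) + Q * (d * (S / N)) := by gcongr
      _ = _ := by ring
  calc ‖a N‖ ≤ K / (N : ℝ) ^ 2 + Q * (S / N) := le_of_mul_le_mul_left hsum hdpos
    _ ≤ K / N + Q * (S / N) := by
        gcongr
        exact le_self_pow₀ hN1 (by norm_num)
    _ = (K + Q * S) / N := by ring
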